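/- Let (W, S) be a Coxeter system, J ⊆ S with W_J finite, and let s ∈ S and w ∈ Y^J be such that s w ∈ Y^J and ℓ(s w) > ℓ(w). Then the set of right inversions of w_J w⁻¹ is not stable under conjugation by s: there exists a reflection t such that exactly one of the two statements 't is a right inversion of w_J w⁻¹' and 's t s is a right inversion of w_J w⁻¹' holds. -/

import Mathlib

namespace CoxeterSystem

open List MulOpposite

variable {B W : Type*} [Group W] {M : CoxeterMatrix B} (cs : CoxeterSystem M W)

open Classical in
/-- The endomap of `W × ZMod 2` attached to a simple reflection `s`, conjugating the first
coordinate by `s` and flipping the second coordinate when the first one equals `s`. Maps are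
composed from left to right. -/
noncomputable def inversionStep (i : B) : (Function.End (W × ZMod 2))ᵐᵒᵖ :=
  op fun p ↦ (cs.simple i * p.1 * cs.simple i, p.2 + if p.1 = cs.simple i then 1 else 0)

open Classical in
theorem count_leftInvSeq_cons (i : B) (ω : List B) (t : W) :
    (cs.leftInvSeq (i :: ω)).count t =
      (if t = cs.simple i then 1 else 0) +
        (cs.leftInvSeq ω).count (cs.simple i * t * cs.simple i) := by
  have hconj : t = MulAut.conj (cs.simple i) (cs.simple i * t * cs.simple i) := by
    simp [mul_assoc]
  rw [leftInvSeq, count_cons, add_comm]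
  congr 1
  · simp only [beq_iff_eq]
    exact if_congr eq_comm rfl rfl
  · conv_lhs => rw [hconj]
    exact List.count_map_of_injective _ _ (MulAut.conj (cs.simple i)).injective _

open Classical in
theorem prod_inversionStep_apply (ω : List B) (t : W) (e : ZMod 2) :
    (ω.map cs.inversionStep).prod.unop (t, e) =
      ((cs.wordProd ω)⁻¹ * t * cs.wordProd ω, e + (cs.leftInvSeq ω).count t) := by
  induction ω generalizing t e with
  | nil =>
    simp [leftInvSeq]
    rfl
  | cons i ω ih =>
    have hstep : ((i :: ω).map cs.inversionStep).prod.unop (t, e) =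
        (ω.map cs.inversionStep).prod.unop (cs.simple i * t * cs.simple i,
          e + if t = cs.simple i then 1 else 0) := by
      simp only [map_cons, prod_cons, unop_mul]
      rfl
    rw [hstep, ih, count_leftInvSeq_cons, wordProd_cons]
    simp [mul_assoc, add_assoc]

theorem prod_map_alternatingWord_two_mul {G : Type*} [Monoid G] (f : B → G) (i j : B) (p : ℕ) :
    ((alternatingWord i j (2 * p)).map f).prod = (f i * f j) ^ p := by
  induction p with
  | zero => simp [alternatingWord]
  | succ p ih =>
    rw [show 2 * (p + 1) = 2 * p + 1 + 1 by ring, alternatingWord_succ, alternatingWord_succ]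
    simp [ih, pow_succ]

open Classical in
theorem even_count_leftInvSeq_alternatingWord (i j : B) (t : W) :
    Even ((cs.leftInvSeq (alternatingWord i j (2 * M i j))).count t) := by
  set l := cs.leftInvSeq (alternatingWord i j (2 * M i j)) with hl
  have hlen : l.length = 2 * M i j := by simp [hl]
  have hperiod : l.drop (M i j) = l.take (M i j) := by
    apply List.ext_getElem
    · simp [hlen]; omega
    · intro k h₁ h₂
      have hk : k < M i j := by simp [hlen] at h₂; omega
      simp only [getElem_drop, getElem_take, hl]
      rw [cs.getElem_leftInvSeq_alternatingWord _ _ _ _ (by omega),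
        cs.getElem_leftInvSeq_alternatingWord _ _ _ _ (by omega)]
      simp only [prod_alternatingWord_eq_mul_pow]
      have h₃ : (2 * (M i j + k) + 1) / 2 = M i j + k := by omega
      have h₄ : (2 * k + 1) / 2 = k := by omega
      rw [h₃, h₄, pow_add, cs.simple_mul_simple_pow' i j]
      simp
  rw [← List.take_append_drop (M i j) l, count_append, hperiod]
  exact ⟨_, rfl⟩

theorem isLiftable_inversionStep : M.IsLiftable cs.inversionStep := by
  classical
  intro i j
  rw [← prod_map_alternatingWord_two_mul]
  apply unop_injective
  funext ⟨t, e⟩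
  rw [prod_inversionStep_apply]
  have hprod : cs.wordProd (alternatingWord i j (2 * M i j)) = 1 := by
    rw [wordProd, prod_map_alternatingWord_two_mul, simple_mul_simple_pow]
  have hzero : (((cs.leftInvSeq (alternatingWord i j (2 * M i j))).count t : ℕ) : ZMod 2) = 0 :=
    (ZMod.natCast_eq_zero_iff_even).2 (cs.even_count_leftInvSeq_alternatingWord i j t)
  rw [hprod, hzero]
  simp
  rfl

/-- The parity of the number of times `t` occurs in the left inversion sequence of any word
for `w`. -/
noncomputable def inversionParity (w t : W) : ZMod 2 :=
  ((cs.lift ⟨cs.inversionStep, cs.isLiftable_inversionStep⟩ w).unop (t, 0)).2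

open Classical in
theorem inversionParity_wordProd (ω : List B) (t : W) :
    cs.inversionParity (cs.wordProd ω) t = (cs.leftInvSeq ω).count t := by
  have h : cs.lift ⟨cs.inversionStep, cs.isLiftable_inversionStep⟩ (cs.wordProd ω) =
      (ω.map cs.inversionStep).prod := by
    rw [wordProd, map_list_prod, List.map_map]
    congr 2
    funext i
    simp
  rw [inversionParity, h, prod_inversionStep_apply, zero_add]

theorem inversionParity_one (t : W) : cs.inversionParity 1 t = 0 := by
  classical
  simpa using cs.inversionParity_wordProd [] t

open Classical in
theorem inversionParity_simple (i : B) (t : W) :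
    cs.inversionParity (cs.simple i) t = if t = cs.simple i then 1 else 0 := by
  have h := cs.inversionParity_wordProd [i] t
  rw [wordProd_singleton] at h
  rw [h, count_leftInvSeq_cons]
  simp

theorem inversionParity_mul (a b t : W) :
    cs.inversionParity (a * b) t =
      cs.inversionParity a t + cs.inversionParity b (a⁻¹ * t * a) := by
  classical
  obtain ⟨ω, rfl⟩ := cs.wordProd_surjective a
  induction ω generalizing t with
  | nil => simp [inversionParity_one]
  | cons i ω ih =>
    have hcons (u t : W) : cs.inversionParity (cs.simple i * u) t =
        cs.inversionParity (cs.simple i) t +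
          cs.inversionParity u (cs.simple i * t * cs.simple i) := by
      obtain ⟨ω, rfl⟩ := cs.wordProd_surjective u
      rw [← wordProd_cons, inversionParity_wordProd, inversionParity_wordProd,
        inversionParity_simple, count_leftInvSeq_cons]
      simp
    rw [wordProd_cons, mul_assoc, hcons, ih, hcons]
    simp [mul_assoc, add_assoc]

theorem inversionParity_inv_conj (w t : W) :
    cs.inversionParity w⁻¹ (w⁻¹ * t * w) = cs.inversionParity w t := by
  have h := cs.inversionParity_mul w w⁻¹ t
  rw [mul_inv_cancel, inversionParity_one] at h
  exact (CharTwo.add_eq_zero.1 h.symm).symm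

theorem IsReflection.inversionParity_self {t : W} (ht : cs.IsReflection t) :
    cs.inversionParity t t = 1 := by
  classical
  obtain ⟨a, i, rfl⟩ := ht
  have h := cs.inversionParity_inv_conj a (a * cs.simple i * a⁻¹)
  rw [inversionParity_mul, inversionParity_mul, ← h]
  simp only [mul_inv_rev, mul_assoc, inv_mul_cancel_left, inv_mul_cancel, mul_one, inv_simple,
    simple_mul_simple_cancel_left, inversionParity_simple, if_true]
  rw [add_right_comm, CharTwo.add_self_eq_zero, zero_add]

theorem isLeftInversion_of_inversionParity_ne_zero {w t : W}
    (h : cs.inversionParity w t ≠ 0) : cs.IsLeftInversion w t := by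
  classical
  obtain ⟨ω, hω, rfl⟩ := cs.exists_isReduced w
  rw [inversionParity_wordProd] at h
  refine cs.isLeftInversion_of_mem_leftInvSeq hω ?_
  by_contra hmem
  exact h (by rw [count_eq_zero_of_not_mem hmem, Nat.cast_zero])

theorem IsReflection.isLeftInversion_iff_inversionParity {t : W} (ht : cs.IsReflection t)
    (w : W) : cs.IsLeftInversion w t ↔ cs.inversionParity w t = 1 := by
  refine ⟨fun h ↦ ?_, fun h ↦
    cs.isLeftInversion_of_inversionParity_ne_zero (by rw [h]; exact one_ne_zero)⟩
  by_contra hne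
  have hzero : cs.inversionParity w t = 0 := by
    revert hne
    generalize cs.inversionParity w t = a
    revert a
    decide
  have hmul : cs.inversionParity (t * w) t = 1 := by
    rw [inversionParity_mul, ht.inversionParity_self]
    simp [hzero]
  have h' := (cs.isLeftInversion_of_inversionParity_ne_zero
    (by rw [hmul]; exact one_ne_zero)).2
  rw [← mul_assoc, ht.mul_self, one_mul] at h'
  exact absurd h.2 h'.le.not_gt

theorem eq_one_of_inversionParity_simple_ne_one {w : W}
    (h : ∀ i, cs.inversionParity w (cs.simple i) ≠ 1) : w = 1 := by
  by_contra hw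
  obtain ⟨i, hi⟩ := cs.exists_leftDescent_of_ne_one hw
  exact h i (((cs.isReflection_simple i).isLeftInversion_iff_inversionParity cs w).1
    ((cs.isLeftInversion_simple_iff_isLeftDescent w i).2 hi))

/-- An element of a standard parabolic subgroup only has inversions in that subgroup. -/
theorem mem_closure_of_inversionParity_ne_zero {J : Set B} {u : W}
    (hu : u ∈ Subgroup.closure (cs.simple '' J)) {t : W} (h : cs.inversionParity u t ≠ 0) :
    t ∈ Subgroup.closure (cs.simple '' J) := by
  classical
  induction hu using Subgroup.closure_induction generalizing t with
  | mem x hx =>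
    obtain ⟨j, hj, rfl⟩ := hx
    rw [inversionParity_simple] at h
    by_cases ht : t = cs.simple j
    · exact ht ▸ Subgroup.subset_closure ⟨j, hj, rfl⟩
    · simp [ht] at h
  | one => exact absurd (cs.inversionParity_one t) h
  | mul x y hx hy ihx ihy =>
    rw [inversionParity_mul] at h
    by_cases hxt : cs.inversionParity x t = 0
    · rw [hxt, zero_add] at h
      have := mul_mem (mul_mem hx (ihy h)) (inv_mem hx)
      simpa [mul_assoc] using this
    · exact ihx hxt
  | inv x hx ih =>
    have hconj := cs.inversionParity_inv_conj x (x * t * x⁻¹)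
    simp only [mul_assoc, inv_mul_cancel_left, inv_mul_cancel, mul_one] at hconj
    rw [hconj] at h
    have := mul_mem (mul_mem (inv_mem hx) (ih h)) hx
    simpa [mul_assoc] using this

/-- A longest element of a standard parabolic subgroup is an involution. -/
theorem mul_self_eq_one_of_longest {J : Set B} {w : W}
    (hw : w ∈ Subgroup.closure (cs.simple '' J))
    (hmax : ∀ u ∈ Subgroup.closure (cs.simple '' J), cs.length u ≤ cs.length w) :
    w * w = 1 := by
  have hinv {t : W} (ht : cs.IsReflection t) (htJ : t ∈ Subgroup.closure (cs.simple '' J)) :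
      cs.inversionParity w t = 1 :=
    (ht.isLeftInversion_iff_inversionParity cs w).1
      ⟨ht, lt_of_le_of_ne (hmax _ (mul_mem htJ hw)) (ht.length_mul_right_ne w)⟩
  apply cs.eq_one_of_inversionParity_simple_ne_one
  intro i hi
  have hiJ := cs.mem_closure_of_inversionParity_ne_zero (mul_mem hw hw)
    (by rw [hi]; exact one_ne_zero)
  have hi_refl := cs.isReflection_simple i
  have hconj : cs.IsReflection (w⁻¹ * cs.simple i * w) := by
    simpa using hi_refl.conj w⁻¹
  rw [inversionParity_mul, hinv hi_refl hiJ,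
    hinv hconj (mul_mem (mul_mem (inv_mem hw) hiJ) hw), CharTwo.add_self_eq_zero] at hi
  exact zero_ne_one hi

/-- If the left inversions of `x` are stable under conjugation by the simple reflection `s`,
then `s * x = x * r` for some simple reflection `r`. -/
theorem exists_simple_mul_eq_mul_simple {x : W} {i : B}
    (h : ∀ t, cs.IsReflection t →
      (cs.IsLeftInversion x t ↔ cs.IsLeftInversion x (cs.simple i * t * cs.simple i))) :
    ∃ j, cs.simple i * x = x * cs.simple j := by
  classical
  have hstable {t : W} (ht : cs.IsReflection t) :
      cs.inversionParity x (cs.simple i * t * cs.simple i) = cs.inversionParity x t := by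
    have ht' : cs.IsReflection (cs.simple i * t * cs.simple i) := by
      simpa using ht.conj (cs.simple i)
    have := h t ht
    rw [ht.isLeftInversion_iff_inversionParity, ht'.isLeftInversion_iff_inversionParity] at this
    revert this
    generalize cs.inversionParity x t = a
    generalize cs.inversionParity x _ = b
    revert a b
    decide
  by_contra! hne
  have hone : x⁻¹ * cs.simple i * x = 1 := by
    apply cs.eq_one_of_inversionParity_simple_ne_one
    intro j hj
    have hconj := (cs.isReflection_simple j).conj x
    have hxj : x * cs.simple j * x⁻¹ ≠ cs.simple i := by
      intro hxj
      exact hne j (by rw [← hxj]; group)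
    have hcancel := cs.inversionParity_inv_conj x (x * cs.simple j * x⁻¹)
    simp only [mul_assoc, inv_mul_cancel_left, inv_mul_cancel, mul_one] at hcancel
    rw [mul_assoc, inversionParity_mul, inv_inv, inversionParity_mul, inversionParity_simple,
      if_neg hxj, zero_add, inv_simple, hstable hconj, hcancel, mul_assoc,
      CharTwo.add_self_eq_zero] at hj
    exact zero_ne_one hj
  have hi : cs.simple i = 1 := by
    calc cs.simple i = x * (x⁻¹ * cs.simple i * x) * x⁻¹ := by group
      _ = 1 := by rw [hone]; group
  have hlen := cs.length_simple i
  rw [hi, length_one] at hlen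
  exact zero_ne_one hlen

end CoxeterSystem

/-!
Let `(W, S)` be a Coxeter system, `J ⊆ S` (encoded by a set of indices `J ⊆ B`) with the
standard parabolic subgroup `W_J` finite and with longest element `w_J`.  Let `s ∈ S` and
`w ∈ Y^J` be such that `s w ∈ Y^J` and `ℓ(s w) > ℓ(w)`.  Then the set of right inversions
of `w_J w⁻¹` is not stable under conjugation by `s`: there is a reflection `t` such that
exactly one of "`t` is a right inversion of `w_J w⁻¹`" and "`s t s` is a right inversion of
`w_J w⁻¹`" holds.

Here `x ∈ W^J` means `x` has minimal length in `x W_J`, and `x ∈ Y^J` means moreover that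
`R(x w_J) = {s ∈ S : ℓ(x w_J s) < ℓ(x w_J)}` equals `J`.
-/
theorem inversion_set_of_YJ_not_stable
    {B : Type*} {W : Type*} [Group W] {M : CoxeterMatrix B} (cs : CoxeterSystem M W)
    (J : Set B) (wJ : W)
    -- `W_J` is finite
    (hfin : ((Subgroup.closure (cs.simple '' J) : Subgroup W) : Set W).Finite)
    -- `w_J` is the longest element of `W_J`
    (hwJ_mem : wJ ∈ Subgroup.closure (cs.simple '' J))
    (hwJ_max : ∀ u ∈ Subgroup.closure (cs.simple '' J), cs.length u ≤ cs.length wJ)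
    (i : B) (w : W)
    -- `w ∈ W^J` and `R(w w_J) = J`, i.e. `w ∈ Y^J`
    (hw_min : ∀ u ∈ Subgroup.closure (cs.simple '' J), cs.length w ≤ cs.length (w * u))
    (hw_R : {j : B | cs.length (w * wJ * cs.simple j) < cs.length (w * wJ)} = J)
    -- `s w ∈ W^J` and `R(s w w_J) = J`, i.e. `s w ∈ Y^J`
    (hsw_min : ∀ u ∈ Subgroup.closure (cs.simple '' J),
      cs.length (cs.simple i * w) ≤ cs.length (cs.simple i * w * u))
    (hsw_R : {j : B | cs.length (cs.simple i * w * wJ * cs.simple j) <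
      cs.length (cs.simple i * w * wJ)} = J)
    -- `ℓ(s w) > ℓ(w)`
    (hlen : cs.length w < cs.length (cs.simple i * w)) :
    ∃ t : W, cs.IsReflection t ∧
      ¬(cs.IsRightInversion (wJ * w⁻¹) t ↔
        cs.IsRightInversion (wJ * w⁻¹) (cs.simple i * t * cs.simple i)) := by
  by_contra! hstable
  have hwJ : wJ⁻¹ = wJ := inv_eq_of_mul_eq_one_left (cs.mul_self_eq_one_of_longest hwJ_mem hwJ_max)
  have hinv : wJ * w⁻¹ = (w * wJ)⁻¹ := by rw [mul_inv_rev, hwJ]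
  simp only [hinv, cs.isRightInversion_inv_iff] at hstable
  obtain ⟨j, hj⟩ := cs.exists_simple_mul_eq_mul_simple hstable
  have hw_j := Set.ext_iff.1 hw_R j
  rw [mul_assoc (cs.simple i), hj] at hsw_R
  have hsw_j := Set.ext_iff.1 hsw_R j
  simp only [Set.mem_ofPred_eq, mul_assoc, cs.simple_mul_simple_self, mul_one] at hw_j hsw_j
  have hne := cs.length_mul_simple_ne (w * wJ) j
  rw [mul_assoc] at hne
  by_cases hJ : j ∈ J
  · exact (hw_j.2 hJ).not_gt (hsw_j.2 hJ)
  · exact hJ (hsw_j.1 (lt_of_le_of_ne (not_lt.1 fun h ↦ hJ (hw_j.1 h)) hne.symm))
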